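/- For every θ > 0 there exist quantities κ₁ and κ₂ (which may depend on n and θ but are bounded uniformly in n) such that E[exp(√(θ log n) · X_{n1})] = κ₁ exp(θ log n/(4β) + κ₂ √(θ log n)), where X_{n1} = D₁ − E[D₁]. Consequently, taking θ = 4α₂β², for iid copies D₁,…,D_n, P(∃ j ≤ n : D_j − E[D_j] > √(α₂ log n)) ≤ κ₁ exp(−(α₂β − 1) log n + 2κ₂β√(α₂ log n)). -/

import Mathlib

open Filter Real

/-- The unnormalized weight `f(k,γ) = (1/k!) exp(-βk² + γ k log n)`. -/
noncomputable def degWeight (β γ : ℝ) (n : ℕ) (k : ℕ) : ℝ :=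
  (1 / (Nat.factorial k : ℝ)) * Real.exp (-β * (k : ℝ) ^ 2 + γ * Real.log n * k)

/-- The probability mass function of `D₁`:
`P(D₁ = k) = F(γ)⁻¹ (1/k!) exp(-βk² + γ (log n) k)`. -/
noncomputable def degPMF (β γ : ℝ) (n : ℕ) (k : ℕ) : ℝ :=
  degWeight β γ n k / (∑' j : ℕ, degWeight β γ n j)

/-- The mean `E[D₁]`. -/
noncomputable def degMean (β γ : ℝ) (n : ℕ) : ℝ :=
  ∑' k : ℕ, (k : ℝ) * degPMF β γ n k

/-- The variance `Var(D₁)`. -/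
noncomputable def degVar (β γ : ℝ) (n : ℕ) : ℝ :=
  ∑' k : ℕ, ((k : ℝ) - degMean β γ n) ^ 2 * degPMF β γ n k


/-- The weight `(1/k!) exp(-βk² + a k)`, with the tilt `a` in place of `γ log n`. -/
noncomputable def tiltWeight (β a : ℝ) (k : ℕ) : ℝ :=
  (1 / (Nat.factorial k : ℝ)) * Real.exp (-β * (k : ℝ) ^ 2 + a * k)

/-- The partition function `∑ k, (1/k!) exp(-βk² + a k)`. -/
noncomputable def partitionFn (β a : ℝ) : ℝ := ∑' k : ℕ, tiltWeight β a k

/-- The first moment `∑ k, k (1/k!) exp(-βk² + a k)` of the unnormalized weights. -/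
noncomputable def firstMoment (β a : ℝ) : ℝ := ∑' k : ℕ, (k : ℝ) * tiltWeight β a k

/-- The mean of the normalized weights with tilt `a`. -/
noncomputable def tiltMean (β a : ℝ) : ℝ := firstMoment β a / partitionFn β a

section TiltedFamily

variable {β : ℝ}

lemma tiltWeight_pos (β a : ℝ) (k : ℕ) : 0 < tiltWeight β a k := by
  unfold tiltWeight; positivity

lemma tiltWeight_add (β a s : ℝ) (k : ℕ) :
    tiltWeight β (a + s) k = Real.exp (s * k) * tiltWeight β a k := by
  unfold tiltWeight
  rw [show -β * (k : ℝ) ^ 2 + (a + s) * k = s * k + (-β * (k : ℝ) ^ 2 + a * k) by ring,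
    Real.exp_add]
  ring

lemma succ_mul_tiltWeight_succ (β a : ℝ) (k : ℕ) :
    ((k + 1 : ℕ) : ℝ) * tiltWeight β a (k + 1) =
      Real.exp (a - β) * tiltWeight β (a - 2 * β) k := by
  unfold tiltWeight
  have h : Real.exp (-β * ((k + 1 : ℕ) : ℝ) ^ 2 + a * ((k + 1 : ℕ) : ℝ)) =
      Real.exp (a - β) * Real.exp (-β * (k : ℝ) ^ 2 + (a - 2 * β) * k) := by
    rw [← Real.exp_add]; congr 1; push_cast; ring
  rw [h, Nat.factorial_succ]
  have := Nat.factorial_pos k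
  push_cast
  field_simp

lemma natCast_mul_tiltWeight_le (hβ : 0 < β) {a R : ℝ} (ha : a ≤ R) (k : ℕ) :
    (k : ℝ) * tiltWeight β a k ≤ Real.exp (R + 1) ^ k / (Nat.factorial k : ℝ) := by
  unfold tiltWeight
  have hk : (0 : ℝ) ≤ k := k.cast_nonneg
  have h1 : (k : ℝ) ≤ Real.exp k := by linarith [Real.add_one_le_exp (k : ℝ)]
  have h2 : Real.exp (-β * (k : ℝ) ^ 2 + a * k) ≤ Real.exp (R * k) := by
    apply Real.exp_le_exp.2
    nlinarith [mul_le_mul_of_nonneg_right ha hk, mul_nonneg hβ.le (sq_nonneg (k : ℝ))]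
  have h3 : Real.exp (R + 1) ^ k = Real.exp k * Real.exp (R * k) := by
    rw [← Real.exp_nat_mul, ← Real.exp_add]; congr 1; ring
  rw [h3, one_div, div_eq_mul_inv]
  calc (k : ℝ) * ((Nat.factorial k : ℝ)⁻¹ * Real.exp (-β * (k : ℝ) ^ 2 + a * k))
      = k * Real.exp (-β * (k : ℝ) ^ 2 + a * k) * (Nat.factorial k : ℝ)⁻¹ := by ring
    _ ≤ Real.exp k * Real.exp (R * k) * (Nat.factorial k : ℝ)⁻¹ := by gcongr

lemma summable_natCast_mul_tiltWeight (hβ : 0 < β) (a : ℝ) :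
    Summable fun k : ℕ => (k : ℝ) * tiltWeight β a k :=
  Summable.of_nonneg_of_le (fun k => mul_nonneg k.cast_nonneg (tiltWeight_pos β a k).le)
    (natCast_mul_tiltWeight_le hβ le_rfl) (Real.summable_pow_div_factorial _)

lemma summable_tiltWeight (hβ : 0 < β) (a : ℝ) : Summable (tiltWeight β a) := by
  rw [← summable_nat_add_iff 1]
  refine Summable.of_nonneg_of_le (fun k => (tiltWeight_pos β a _).le) (fun k => ?_)
    ((summable_nat_add_iff 1).2 (summable_natCast_mul_tiltWeight hβ a))
  have := tiltWeight_pos β a (k + 1)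
  push_cast
  nlinarith [(k.cast_nonneg : (0 : ℝ) ≤ k)]

lemma partitionFn_pos (hβ : 0 < β) (a : ℝ) : 0 < partitionFn β a :=
  (summable_tiltWeight hβ a).tsum_pos (fun k => (tiltWeight_pos β a k).le) 0
    (tiltWeight_pos β a 0)

lemma firstMoment_eq (hβ : 0 < β) (a : ℝ) :
    firstMoment β a = Real.exp (a - β) * partitionFn β (a - 2 * β) := by
  unfold firstMoment partitionFn
  rw [(summable_natCast_mul_tiltWeight hβ a).tsum_eq_zero_add, ← tsum_mul_left]
  simp_rw [succ_mul_tiltWeight_succ]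
  simp

lemma firstMoment_pos (hβ : 0 < β) (a : ℝ) : 0 < firstMoment β a := by
  rw [firstMoment_eq hβ]
  exact mul_pos (Real.exp_pos _) (partitionFn_pos hβ _)

lemma tiltMean_pos (hβ : 0 < β) (a : ℝ) : 0 < tiltMean β a :=
  div_pos (firstMoment_pos hβ a) (partitionFn_pos hβ a)

/-- An affine lower bound on `g` tangent at the mean gives Jensen's inequality. -/
lemma mul_partitionFn_le_tsum (hβ : 0 < β) (a y b : ℝ) {g : ℕ → ℝ}
    (hg : Summable fun k => g k * tiltWeight β a k)
    (h : ∀ k : ℕ, y + b * (k - tiltMean β a) ≤ g k) :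
    y * partitionFn β a ≤ ∑' k, g k * tiltWeight β a k := by
  have h0 := (summable_tiltWeight hβ a).hasSum
  have h1 := (summable_natCast_mul_tiltWeight hβ a).hasSum
  have h2 := (h0.mul_left (y - b * tiltMean β a)).add (h1.mul_left b)
  have h3 := hasSum_le (fun k => ?_) h2 hg.hasSum
  · refine le_trans (le_of_eq ?_) h3
    change y * partitionFn β a =
      (y - b * tiltMean β a) * partitionFn β a + b * firstMoment β a
    have : tiltMean β a * partitionFn β a = firstMoment β a :=
      div_mul_cancel₀ _ (partitionFn_pos hβ a).ne'
    linear_combination b * this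
  · have := mul_le_mul_of_nonneg_right (h k) (tiltWeight_pos β a k).le
    linarith

lemma tilt_le (hβ : 0 < β) (a : ℝ) :
    a ≤ Real.log (tiltMean β a) + 2 * β * tiltMean β a + β := by
  have hm := tiltMean_pos hβ a
  have hZ := partitionFn_pos hβ a
  have key : Real.exp (-(2 * β * tiltMean β a)) * partitionFn β a ≤
      partitionFn β (a - 2 * β) := by
    have hs : (fun k : ℕ => Real.exp (-(2 * β) * k) * tiltWeight β a k) =
        tiltWeight β (a - 2 * β) := by
      ext k; rw [sub_eq_add_neg, tiltWeight_add]
    have := mul_partitionFn_le_tsum hβ a (Real.exp (-(2 * β * tiltMean β a)))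
      (-(2 * β) * Real.exp (-(2 * β * tiltMean β a)))
      (g := fun k : ℕ => Real.exp (-(2 * β) * k))
      (by rw [hs]; exact summable_tiltWeight hβ _) (fun k => ?_)
    · rwa [hs] at this
    · have h1 := Real.add_one_le_exp (-(2 * β) * (k - tiltMean β a))
      have h2 : Real.exp (-(2 * β) * k) = Real.exp (-(2 * β * tiltMean β a)) *
          Real.exp (-(2 * β) * (k - tiltMean β a)) := by
        rw [← Real.exp_add]; congr 1; ring
      rw [h2]
      nlinarith [Real.exp_pos (-(2 * β * tiltMean β a))]
  have h1 : Real.exp (a - β) * Real.exp (-(2 * β * tiltMean β a)) ≤ tiltMean β a := by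
    have h2 : tiltMean β a * partitionFn β a = firstMoment β a := div_mul_cancel₀ _ hZ.ne'
    refine le_of_mul_le_mul_right ?_ hZ
    rw [h2, firstMoment_eq hβ, mul_assoc]
    gcongr
  rw [← Real.exp_add, ← Real.le_log_iff_exp_le hm] at h1
  linarith

lemma le_tilt (hβ : 0 < β) (a : ℝ) :
    Real.log (tiltMean β a) + 2 * β * tiltMean β a - β ≤ a := by
  have hm := tiltMean_pos hβ a
  have hZ := partitionFn_pos hβ a
  have hs : (fun k : ℕ => ((k : ℝ) * Real.exp (2 * β * k)) * tiltWeight β a k) =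
      fun k : ℕ => (k : ℝ) * tiltWeight β (a + 2 * β) k := by
    ext k; rw [tiltWeight_add]; ring
  have key := mul_partitionFn_le_tsum hβ a
    (tiltMean β a * Real.exp (2 * β * tiltMean β a))
    ((1 + 2 * β * tiltMean β a) * Real.exp (2 * β * tiltMean β a))
    (g := fun k : ℕ => (k : ℝ) * Real.exp (2 * β * k))
    (by rw [hs]; exact summable_natCast_mul_tiltWeight hβ _) (fun k => ?_)
  · rw [hs] at key
    change _ ≤ firstMoment β (a + 2 * β) at key
    rw [firstMoment_eq hβ, add_sub_cancel_right] at key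
    have h1 := Real.log_le_log (by positivity) (le_of_mul_le_mul_right key hZ)
    rw [Real.log_mul hm.ne' (Real.exp_pos _).ne', Real.log_exp, Real.log_exp] at h1
    linarith
  · set m := tiltMean β a
    have hk : (0 : ℝ) ≤ k := k.cast_nonneg
    have h1 := Real.add_one_le_exp (2 * β * (k - m))
    have h2 : Real.exp (2 * β * k) = Real.exp (2 * β * m) * Real.exp (2 * β * (k - m)) := by
      rw [← Real.exp_add]; congr 1; ring
    have h3 : m + (1 + 2 * β * m) * (k - m) ≤ k * Real.exp (2 * β * (k - m)) := by
      nlinarith [mul_le_mul_of_nonneg_left h1 hk, mul_nonneg hβ.le (sq_nonneg ((k : ℝ) - m))]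
    calc m * Real.exp (2 * β * m) + (1 + 2 * β * m) * Real.exp (2 * β * m) * (k - m)
        = Real.exp (2 * β * m) * (m + (1 + 2 * β * m) * (k - m)) := by ring
      _ ≤ Real.exp (2 * β * m) * (k * Real.exp (2 * β * (k - m))) := by gcongr
      _ = k * Real.exp (2 * β * k) := by rw [h2]; ring

lemma hasDerivAt_partitionFn (hβ : 0 < β) (a : ℝ) :
    HasDerivAt (partitionFn β) (firstMoment β a) a := by
  refine hasDerivAt_tsum_of_isPreconnected (t := Set.Iio (a + 1)) (y₀ := a)
    (Real.summable_pow_div_factorial (Real.exp (a + 1 + 1))) isOpen_Iio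
    (convex_Iio (a + 1)).isPreconnected (g := fun k b => tiltWeight β b k)
    (g' := fun k b => (k : ℝ) * tiltWeight β b k) (fun k b _ => ?_) (fun k b hb => ?_)
    (by simp) (summable_tiltWeight hβ a) (by simp)
  · unfold tiltWeight
    have h : HasDerivAt (fun b : ℝ => -β * (k : ℝ) ^ 2 + b * k) (k : ℝ) b := by
      simpa using ((hasDerivAt_id b).mul_const (k : ℝ)).const_add (-β * (k : ℝ) ^ 2)
    exact (h.exp.const_mul (1 / (Nat.factorial k : ℝ))).congr_deriv (by ring)
  · rw [Real.norm_of_nonneg (mul_nonneg k.cast_nonneg (tiltWeight_pos β b k).le)]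
    exact natCast_mul_tiltWeight_le hβ (le_of_lt hb) k

lemma hasDerivAt_log_partitionFn (hβ : 0 < β) (a t : ℝ) :
    HasDerivAt (fun t => Real.log (partitionFn β (a + t)) - t * tiltMean β a)
      (tiltMean β (a + t) - tiltMean β a) t := by
  have h1 : HasDerivAt (fun t => partitionFn β (a + t)) (firstMoment β (a + t)) t :=
    (hasDerivAt_partitionFn hβ (a + t)).comp_const_add a t
  have h2 := (h1.log (partitionFn_pos hβ _).ne').sub
    ((hasDerivAt_id t).mul_const (tiltMean β a))
  exact h2.congr_deriv (by simp [tiltMean])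

lemma tiltMean_add_sub_le (hβ : 0 < β) (a : ℝ) {t : ℝ} (ht : 0 ≤ t) :
    tiltMean β (a + t) - tiltMean β a ≤ t / (2 * β) + 1 := by
  have h1 := le_tilt hβ (a + t)
  have h2 := tilt_le hβ a
  have hm := tiltMean_pos hβ a
  rcases le_total (tiltMean β (a + t)) (tiltMean β a) with h | h
  · have : 0 ≤ t / (2 * β) := by positivity
    linarith
  · have := Real.log_le_log hm h
    rw [div_add_one (by positivity), le_div_iff₀ (by positivity)]
    linarith

lemma le_tiltMean_add_sub (hβ : 0 < β) (a t : ℝ) :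
    (t - 2 * β) / (2 * β + 1 / tiltMean β a) ≤ tiltMean β (a + t) - tiltMean β a := by
  have h1 := tilt_le hβ (a + t)
  have h2 := le_tilt hβ a
  have hm := tiltMean_pos hβ a
  have hm' := tiltMean_pos hβ (a + t)
  have h3 := Real.log_le_sub_one_of_pos (div_pos hm' hm)
  rw [Real.log_div hm'.ne' hm.ne'] at h3
  rw [div_le_iff₀ (by positivity)]
  have h4 : (tiltMean β (a + t) - tiltMean β a) * (2 * β + 1 / tiltMean β a) =
      2 * β * (tiltMean β (a + t) - tiltMean β a) +
        (tiltMean β (a + t) / tiltMean β a - 1) := by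
    field_simp
  rw [h4]
  linarith

lemma log_partitionFn_add_le (hβ : 0 < β) (a : ℝ) {s : ℝ} (hs : 0 ≤ s) :
    Real.log (partitionFn β (a + s)) - Real.log (partitionFn β a) - s * tiltMean β a ≤
      s ^ 2 / (4 * β) + s := by
  have hd (t : ℝ) := (((hasDerivAt_pow 2 t).div_const (4 * β)).add (hasDerivAt_id t)).sub
    (hasDerivAt_log_partitionFn hβ a t)
  have hmono := monotoneOn_of_hasDerivWithinAt_nonneg (convex_Ici (0 : ℝ))
    (fun t _ => (hd t).continuousAt.continuousWithinAt)
    (fun t _ => (hd t).hasDerivWithinAt) (fun t ht => ?_)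
  · have := hmono Set.self_mem_Ici hs hs
    simp at this
    linarith
  · rw [interior_Ici] at ht
    have := tiltMean_add_sub_le hβ a (le_of_lt ht)
    have h2 : ((2 : ℕ) : ℝ) * t ^ (2 - 1) / (4 * β) = t / (2 * β) := by
      field_simp; norm_num; ring
    rw [h2]
    linarith

lemma le_log_partitionFn_add (hβ : 0 < β) (a : ℝ) {s : ℝ} (hs : 0 ≤ s) :
    (s ^ 2 / 2 - 2 * β * s) / (2 * β + 1 / tiltMean β a) ≤
      Real.log (partitionFn β (a + s)) - Real.log (partitionFn β a) - s * tiltMean β a := by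
  have hd (t : ℝ) := (hasDerivAt_log_partitionFn hβ a t).sub
    ((((hasDerivAt_pow 2 t).div_const 2).sub ((hasDerivAt_id t).const_mul (2 * β))).div_const
      (2 * β + 1 / tiltMean β a))
  have hmono := monotoneOn_of_hasDerivWithinAt_nonneg (convex_Ici (0 : ℝ))
    (fun t _ => (hd t).continuousAt.continuousWithinAt)
    (fun t _ => (hd t).hasDerivWithinAt) (fun t ht => ?_)
  · have := hmono Set.self_mem_Ici hs hs
    simp at this
    rw [one_div]
    linarith
  · have := le_tiltMean_add_sub hβ a t
    have h2 : ((2 : ℕ) : ℝ) * t ^ (2 - 1) / 2 - 2 * β * 1 = t - 2 * β := by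
      norm_num
    rw [h2]
    linarith

lemma abs_log_partitionFn_add_sub_le (hβ : 0 < β) (a : ℝ) {s : ℝ} (hs : 0 ≤ s) :
    |Real.log (partitionFn β (a + s)) - Real.log (partitionFn β a) - s * tiltMean β a -
      s ^ 2 / (4 * β)| ≤ s + s ^ 2 / (8 * β ^ 2 * tiltMean β a) := by
  have h1 := log_partitionFn_add_le hβ a hs
  have h2 := le_log_partitionFn_add hβ a hs
  have hm := tiltMean_pos hβ a
  set m := tiltMean β a
  have h3 : s ^ 2 / (4 * β) - s - s ^ 2 / (8 * β ^ 2 * m) ≤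
      (s ^ 2 / 2 - 2 * β * s) / (2 * β + 1 / m) := by
    rw [le_div_iff₀ (by positivity)]
    have : (s ^ 2 / (4 * β) - s - s ^ 2 / (8 * β ^ 2 * m)) * (2 * β + 1 / m) =
        s ^ 2 / 2 - 2 * β * s - s / m - s ^ 2 / (8 * β ^ 2 * m ^ 2) := by
      field_simp; ring
    rw [this]
    have : 0 ≤ s / m := by positivity
    have : 0 ≤ s ^ 2 / (8 * β ^ 2 * m ^ 2) := by positivity
    linarith
  have h4 : 0 ≤ s ^ 2 / (8 * β ^ 2 * m) := by positivity
  rw [abs_le]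
  constructor <;> linarith

end TiltedFamily

lemma degMean_eq_tiltMean (β γ : ℝ) (n : ℕ) :
    degMean β γ n = tiltMean β (γ * Real.log n) := by
  change ∑' k : ℕ, (k : ℝ) * (tiltWeight β (γ * Real.log n) k / partitionFn β _) = _
  simp_rw [← mul_div_assoc]
  exact tsum_div_const

lemma degPMF_nonneg (β γ : ℝ) (n k : ℕ) : 0 ≤ degPMF β γ n k :=
  div_nonneg (tiltWeight_pos β (γ * Real.log n) k).le
    (tsum_nonneg fun k => (tiltWeight_pos β (γ * Real.log n) k).le)

lemma hasSum_degPMF {β : ℝ} (hβ : 0 < β) (γ : ℝ) (n : ℕ) : HasSum (degPMF β γ n) 1 := by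
  have := (summable_tiltWeight hβ (γ * Real.log n)).hasSum.div_const
    (partitionFn β (γ * Real.log n))
  rwa [← partitionFn, div_self (partitionFn_pos hβ _).ne'] at this

lemma hasSum_exp_mul_degPMF {β : ℝ} (hβ : 0 < β) (γ : ℝ) (n : ℕ) (s : ℝ) :
    HasSum (fun k : ℕ => Real.exp (s * ((k : ℝ) - degMean β γ n)) * degPMF β γ n k)
      (Real.exp (Real.log (partitionFn β (γ * Real.log n + s)) -
        Real.log (partitionFn β (γ * Real.log n)) - s * tiltMean β (γ * Real.log n))) := by
  set a := γ * Real.log n with ha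
  have h := ((summable_tiltWeight hβ (a + s)).hasSum.div_const (partitionFn β a)).mul_right
    (Real.exp (-(s * tiltMean β a)))
  convert! h using 1
  · funext k
    rw [tiltWeight_add, degMean_eq_tiltMean, ← ha, mul_sub, sub_eq_add_neg, Real.exp_add]
    change _ * (tiltWeight β a k / partitionFn β a) = _
    ring
  · rw [sub_eq_add_neg, Real.exp_add, Real.exp_sub, Real.exp_log (partitionFn_pos hβ _),
      Real.exp_log (partitionFn_pos hβ _)]
    rfl

lemma hasSum_pi_prod_of_nonneg {n : ℕ} {f : Fin n → ℕ → ℝ} {x : Fin n → ℝ}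
    (hf : ∀ i k, 0 ≤ f i k) (h : ∀ i, HasSum (f i) (x i)) :
    HasSum (fun d : Fin n → ℕ => ∏ i, f i (d i)) (∏ i, x i) := by
  induction n with
  | zero => simp
  | succ n ih =>
    have ih' := ih (fun i => hf i.succ) (fun i => h i.succ)
    have hs := (h 0).summable.mul_of_nonneg ih'.summable (hf 0)
      (fun d => Finset.prod_nonneg fun i _ => hf i.succ (d i))
    rw [← (Fin.consEquiv fun _ : Fin (n + 1) => ℕ).hasSum_iff, Fin.prod_univ_succ]
    convert! (h 0).mul ih' hs using 1
    funext d
    simp [Fin.prod_univ_succ]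

open scoped Classical in
/-- Chernoff's inequality and the union bound for `n` iid copies with mass function `p`. -/
lemma tsum_exists_lt_le {n : ℕ} {p : ℕ → ℝ} (hp : ∀ k, 0 ≤ p k) (hp1 : HasSum p 1)
    {s t m M : ℝ} (hs : 0 ≤ s)
    (hM : HasSum (fun k : ℕ => Real.exp (s * ((k : ℝ) - m)) * p k) M) :
    (∑' d : Fin n → ℕ, if ∃ j, t < (d j : ℝ) - m then ∏ i, p (d i) else 0) ≤
      n * (Real.exp (-(s * t)) * M) := by
  have hterm (j : Fin n) : HasSum
      (fun d : Fin n → ℕ => Real.exp (-(s * t)) *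
        (Real.exp (s * ((d j : ℝ) - m)) * ∏ i, p (d i))) (Real.exp (-(s * t)) * M) := by
    have h := hasSum_pi_prod_of_nonneg
      (f := fun i k => (if i = j then Real.exp (s * ((k : ℝ) - m)) else 1) * p k)
      (x := fun i => if i = j then M else 1)
      (fun i k => by have := hp k; positivity)
      (fun i => by by_cases hi : i = j <;> simp [hi, hM, hp1])
    simp only [Finset.prod_mul_distrib, Finset.prod_ite_eq', Finset.mem_univ, if_true] at h
    exact h.mul_left _
  have hsum := hasSum_sum (s := Finset.univ) fun j _ => hterm j
  simp only [Finset.sum_const, Finset.card_univ, Fintype.card_fin, nsmul_eq_mul] at hsum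
  have hprod (d : Fin n → ℕ) : 0 ≤ ∏ i, p (d i) := Finset.prod_nonneg fun i _ => hp _
  have hle (d : Fin n → ℕ) : (if ∃ j, t < (d j : ℝ) - m then ∏ i, p (d i) else 0) ≤
      ∑ j, Real.exp (-(s * t)) * (Real.exp (s * ((d j : ℝ) - m)) * ∏ i, p (d i)) := by
    have hnn (j : Fin n) : 0 ≤ Real.exp (-(s * t)) *
        (Real.exp (s * ((d j : ℝ) - m)) * ∏ i, p (d i)) := by
      have := hprod d; positivity
    split_ifs with hd
    · obtain ⟨j, hj⟩ := hd
      refine le_trans ?_ (Finset.single_le_sum (fun j _ => hnn j) (Finset.mem_univ j))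
      rw [← mul_assoc, ← Real.exp_add]
      refine le_mul_of_one_le_left (hprod d) (Real.one_le_exp ?_)
      nlinarith
    · exact Finset.sum_nonneg fun j _ => hnn j
  have hsummable := Summable.of_nonneg_of_le
    (fun d => by split_ifs <;> first | exact hprod d | exact le_rfl) hle hsum.summable
  exact hasSum_le hle hsummable.hasSum hsum

open scoped Classical in
/-- **Lemma (exponential moments and Chernoff bound).** For every `θ > 0` there exist
quantities `κ₁, κ₂` (depending on `n` and `θ` but bounded uniformly in `n`) such that
`E[exp(√(θ log n) X_{n1})] = κ₁ exp(θ log n/(4β) + κ₂ √(θ log n))`, where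
`X_{n1} = D₁ - E[D₁]`. Consequently, taking `θ = 4α₂β²`, for iid copies `D₁,…,D_n`,
`P(∃ j ≤ n : D_j - E[D_j] > √(α₂ log n)) ≤ κ₁ exp(-(α₂β - 1) log n + 2κ₂β√(α₂ log n))`. -/
theorem chernoff_bound (β c : ℝ) (hβ : 0 < β) (hc : 0 < c)
    (γ : ℕ → ℝ) (hγ : ∀ n, 0 < γ n)
    (hmean : ∀ n : ℕ, 2 ≤ n → degMean β (γ n) n = c * Real.log n)
    (θ : ℝ) (hθ : 0 < θ) :
    ∃ κ₁ κ₂ : ℕ → ℝ,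
      (∃ C : ℝ, ∀ n : ℕ, 2 ≤ n → |κ₁ n| ≤ C ∧ |κ₂ n| ≤ C) ∧
      (∀ n : ℕ, 2 ≤ n →
        (∑' k : ℕ,
            Real.exp (Real.sqrt (θ * Real.log n) * ((k : ℝ) - degMean β (γ n) n)) *
              degPMF β (γ n) n k)
          = κ₁ n * Real.exp (θ * Real.log n / (4 * β) +
              κ₂ n * Real.sqrt (θ * Real.log n))) ∧
      (∀ α₂ : ℝ, 0 < α₂ → θ = 4 * α₂ * β ^ 2 → ∀ n : ℕ, 2 ≤ n →
        (∑' d : Fin n → ℕ,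
            if ∃ j : Fin n, Real.sqrt (α₂ * Real.log n) < (d j : ℝ) - degMean β (γ n) n then
              ∏ i : Fin n, degPMF β (γ n) n (d i)
            else 0)
          ≤ κ₁ n * Real.exp (-(α₂ * β - 1) * Real.log n +
              2 * κ₂ n * β * Real.sqrt (α₂ * Real.log n))) := by
  set s : ℕ → ℝ := fun n => Real.sqrt (θ * Real.log n) with hs_def
  set L : ℕ → ℝ := fun n => Real.log (partitionFn β (γ n * Real.log n + s n)) -
    Real.log (partitionFn β (γ n * Real.log n)) - s n * tiltMean β (γ n * Real.log n) with hL
  have hlog (n : ℕ) (hn : 2 ≤ n) : Real.log 2 ≤ Real.log n :=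
    Real.log_le_log two_pos (by exact_mod_cast hn)
  have hlog2 : 0 < Real.log 2 := Real.log_pos one_lt_two
  have hs2 (n : ℕ) (hn : 2 ≤ n) : s n ^ 2 = θ * Real.log n :=
    Real.sq_sqrt (mul_nonneg hθ.le (hlog2.le.trans (hlog n hn)))
  have hsmin : 0 < Real.sqrt (θ * Real.log 2) := Real.sqrt_pos.2 (by positivity)
  have hsle (n : ℕ) (hn : 2 ≤ n) : Real.sqrt (θ * Real.log 2) ≤ s n :=
    Real.sqrt_le_sqrt (mul_le_mul_of_nonneg_left (hlog n hn) hθ.le)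
  have hexp (n : ℕ) (hn : 2 ≤ n) : L n =
      θ * Real.log n / (4 * β) + (L n - s n ^ 2 / (4 * β)) / s n * s n := by
    rw [div_mul_cancel₀ _ (hsmin.trans_le (hsle n hn)).ne', hs2 n hn]
    ring
  refine ⟨fun _ => 1, fun n => (L n - s n ^ 2 / (4 * β)) / s n,
    ⟨1 + θ / (8 * β ^ 2 * c) / Real.sqrt (θ * Real.log 2), fun n hn => ⟨?_, ?_⟩⟩,
    fun n hn => ?_, fun α₂ hα₂ hθα n hn => ?_⟩
  · rw [abs_one]
    exact le_add_of_nonneg_right (by positivity)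
  · have hsn := hsmin.trans_le (hsle n hn)
    have hln := hlog2.trans_le (hlog n hn)
    have h := abs_log_partitionFn_add_sub_le hβ (γ n * Real.log n) hsn.le
    rw [← degMean_eq_tiltMean, hmean n hn] at h
    have h1 : s n ^ 2 / (8 * β ^ 2 * (c * Real.log n)) = θ / (8 * β ^ 2 * c) := by
      rw [hs2 n hn]; field_simp
    rw [h1] at h
    rw [abs_div, abs_of_pos hsn, div_le_iff₀ hsn, add_mul, one_mul]
    simp only [hL]
    rw [← degMean_eq_tiltMean, hmean n hn]
    refine h.trans (add_le_add le_rfl ?_)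
    rw [div_mul_eq_mul_div, le_div_iff₀ hsmin]
    exact mul_le_mul_of_nonneg_left (hsle n hn) (by positivity)
  · rw [(hasSum_exp_mul_degPMF hβ (γ n) n (s n)).tsum_eq, one_mul]
    exact congrArg Real.exp (hexp n hn)
  · have hsn := hsmin.trans_le (hsle n hn)
    have hln := hlog2.trans_le (hlog n hn)
    have hst : s n = 2 * β * Real.sqrt (α₂ * Real.log n) := by
      simp only [hs_def]
      rw [hθα, show 4 * α₂ * β ^ 2 * Real.log n = (2 * β) ^ 2 * (α₂ * Real.log n) by ring,
        Real.sqrt_mul (by positivity), Real.sqrt_sq (by positivity)]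
    have hsq : Real.sqrt (α₂ * Real.log n) ^ 2 = α₂ * Real.log n :=
      Real.sq_sqrt (by positivity)
    refine (tsum_exists_lt_le (degPMF_nonneg β (γ n) n) (hasSum_degPMF hβ (γ n) n) hsn.le
      (hasSum_exp_mul_degPMF hβ (γ n) n (s n))).trans (le_of_eq ?_)
    change (n : ℝ) * (Real.exp _ * Real.exp (L n)) = _
    beta_reduce
    have hn0 : (0 : ℝ) < n := by positivity
    rw [one_mul, ← Real.exp_add]
    nth_rewrite 1 [← Real.exp_log hn0]
    rw [← Real.exp_add]
    congr 1
    have h1 := hexp n hn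
    have h2 : θ * Real.log n / (4 * β) = α₂ * β * Real.log n := by
      rw [hθα]; field_simp
    rw [h2] at h1
    generalize (L n - s n ^ 2 / (4 * β)) / s n = κ at h1 ⊢
    rw [h1, hst]
    linear_combination (-2 * β) * hsq
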